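/- Let B(K) act on H = HS(K) by left multiplications with separating and cyclic vector x0. For a normal completely bounded map φ : B(K) → B(K), the following are equivalent: (i) φ is positive; (ii) ⟨C_φ, σ′·τ⟩ ≥ 0 for every positive normal functional σ′ on the commutant B(K)′ = R_{B(K)} and every positive normal functional τ on B(K). -/

import Mathlib

set_option synthInstance.maxHeartbeats 1000000
set_option maxHeartbeats 1000000

noncomputable section

open scoped InnerProductSpace ComplexOrder
open ContinuousLinearMap

local notation "⟪" x ", " y "⟫" => @inner ℂ _ _ x y

namespace ChoiInf

variable {H : Type*} [NormedAddCommGroup H] [InnerProductSpace ℂ H] [CompleteSpace H]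

/-- The rank one operator `x ⊠ y : z ↦ (z|y)·x = ⟪y, z⟫ • x`
(inner products written with Mathlib's convention: conjugate linear in the
first variable, so that the paper's `(z|y)` is `⟪y, z⟫`). -/
def rankOne (x y : H) : H →L[ℂ] H := (innerSL ℂ y).smulRight x

/-- The trace of an operator, computed relative to a Hilbert basis:
`Tr X = Σᵢ (X eᵢ | eᵢ) = Σᵢ ⟪eᵢ, X eᵢ⟫`.  (For trace class operators this does
not depend on the choice of basis.) -/
def tr {ι : Type*} (b : HilbertBasis ι ℂ H) (T : H →L[ℂ] H) : ℂ :=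
  ∑' i, ⟪b i, T (b i)⟫

/-- The bilinear pairing `⟨A, B⟩ = Tr (A B)` between `B(H)` and `T(H)`. -/
def pairing {ι : Type*} (b : HilbertBasis ι ℂ H) (A T : H →L[ℂ] H) : ℂ :=
  tr b (A ∘L T)

/-- Trace class operators, characterized by nuclear representations
`T = Σₙ xₙ ⊠ yₙ` with `Σₙ ‖xₙ‖‖yₙ‖ < ∞`. -/
def IsTraceClass (T : H →L[ℂ] H) : Prop :=
  ∃ x y : ℕ → H, Summable (fun n => ‖x n‖ * ‖y n‖) ∧
    ∀ z, T z = ∑' n, ⟪y n, z⟫ • x n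

/-- The trace norm, as the infimum of `Σₙ ‖xₙ‖‖yₙ‖` over all nuclear
representations `T = Σₙ xₙ ⊠ yₙ`. -/
def traceNorm (T : H →L[ℂ] H) : ℝ :=
  sInf {c : ℝ | ∃ x y : ℕ → H, HasSum (fun n => ‖x n‖ * ‖y n‖) c ∧
    ∀ z, T z = ∑' n, ⟪y n, z⟫ • x n}

/-- `(Φ, Φst)` is a dual pair:  `Φst` preserves the trace class and
`⟨Φ A, T⟩ = ⟨A, Φst T⟩` for all trace class `T`.  A linear map `Φ` on `B(H)` is
normal (σ-weakly continuous) precisely when it admits such a predual map `Φst`. -/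
def IsNormalPair {ι : Type*} (b : HilbertBasis ι ℂ H)
    (Φ Φst : (H →L[ℂ] H) →ₗ[ℂ] (H →L[ℂ] H)) : Prop :=
  (∀ T, IsTraceClass T → IsTraceClass (Φst T)) ∧
    ∀ A T, IsTraceClass T → pairing b (Φ A) T = pairing b A (Φst T)

/-- Positivity of a `k × k` matrix of operators, i.e. positivity of the
corresponding operator on `H ⊕ ⋯ ⊕ H`. -/
def MatPos {k : ℕ} (A : Fin k → Fin k → (H →L[ℂ] H)) : Prop :=
  ∀ v : Fin k → H, 0 ≤ ∑ i, ∑ j, ⟪v i, A i j (v j)⟫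

/-- The operator on `H ⊕ ⋯ ⊕ H` given by a `k × k` matrix of operators has norm `≤ c`. -/
def matNormLe {k : ℕ} (A : Fin k → Fin k → (H →L[ℂ] H)) (c : ℝ) : Prop :=
  ∀ v w : Fin k → H,
    ‖∑ i, ∑ j, ⟪w i, A i j (v j)⟫‖ ≤
      c * Real.sqrt (∑ i, ‖v i‖ ^ 2) * Real.sqrt (∑ i, ‖w i‖ ^ 2)

/-- A von Neumann algebra is a factor when its center consists of the scalars. -/
def IsFactor (M : VonNeumannAlgebra H) : Prop :=
  ∀ T ∈ M, T ∈ M.commutant → ∃ c : ℂ, T = c • (1 : H →L[ℂ] H)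

/-- `x0` is a cyclic vector for `M`. -/
def Cyclic (M : VonNeumannAlgebra H) (x0 : H) : Prop :=
  Dense {y : H | ∃ A ∈ M, A x0 = y}

/-- `x0` is a separating vector for `M`. -/
def Separating (M : VonNeumannAlgebra H) (x0 : H) : Prop :=
  ∀ A ∈ M, A x0 = 0 → A = 0

/-- `Φ` restricts on `alg(M', M)` to the map `φ̃ : A'B ↦ A'·φ(B)`.
(Maps `φ : M → M` are encoded as linear maps on `B(H)` sending `M` into `M`;
only the restriction to `M` is relevant.) -/
def ExtendsTilde (M : VonNeumannAlgebra H)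
    (φ Φ : (H →L[ℂ] H) →ₗ[ℂ] (H →L[ℂ] H)) : Prop :=
  ∀ A' ∈ M.commutant, ∀ B ∈ M, Φ (A' * B) = A' * φ B

/-- The space `CB^σ_ε(M)` of maps `φ : M → M` such that `φ̃` extends to a normal
map on `B(H)`. -/
def CBSigmaE {ι : Type*} (b : HilbertBasis ι ℂ H) (M : VonNeumannAlgebra H) :
    Set ((H →L[ℂ] H) →ₗ[ℂ] (H →L[ℂ] H)) :=
  {φ | (∀ B ∈ M, φ B ∈ M) ∧
    ∃ Φ Φst, ExtendsTilde M φ Φ ∧ IsNormalPair b Φ Φst}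

/-- `φ` is completely positive as a map on `M`. -/
def IsCPOn (M : VonNeumannAlgebra H) (φ : (H →L[ℂ] H) →ₗ[ℂ] (H →L[ℂ] H)) : Prop :=
  ∀ (k : ℕ) (A : Fin k → Fin k → (H →L[ℂ] H)), (∀ i j, A i j ∈ M) →
    MatPos A → MatPos fun i j => φ (A i j)

/-- `φ` is completely positive (on all of `B(H)`). -/
def IsCPFull (φ : (H →L[ℂ] H) →ₗ[ℂ] (H →L[ℂ] H)) : Prop :=
  ∀ (k : ℕ) (A : Fin k → Fin k → (H →L[ℂ] H)), MatPos A → MatPos fun i j => φ (A i j)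

/-- `c` is a completely bounded bound for `φ` as a map on `M`. -/
def CBBoundOn (M : VonNeumannAlgebra H) (φ : (H →L[ℂ] H) →ₗ[ℂ] (H →L[ℂ] H))
    (c : ℝ) : Prop :=
  ∀ (k : ℕ) (A : Fin k → Fin k → (H →L[ℂ] H)), (∀ i j, A i j ∈ M) →
    matNormLe A 1 → matNormLe (fun i j => φ (A i j)) c

/-- The completely bounded norm of `φ` as a map on `M`. -/
def cbNormOn (M : VonNeumannAlgebra H) (φ : (H →L[ℂ] H) →ₗ[ℂ] (H →L[ℂ] H)) : ℝ :=
  sInf {c : ℝ | 0 ≤ c ∧ CBBoundOn M φ c}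

/-- `φ` is completely bounded as a map on `M`. -/
def IsCBOn (M : VonNeumannAlgebra H) (φ : (H →L[ℂ] H) →ₗ[ℂ] (H →L[ℂ] H)) : Prop :=
  ∃ c, 0 ≤ c ∧ CBBoundOn M φ c

/-- `φ` is normal as a map on `M`: every normal functional composed with `φ`
is again normal (i.e. implemented by a trace class operator). -/
def NormalOn {ι : Type*} (b : HilbertBasis ι ℂ H) (M : VonNeumannAlgebra H)
    (φ : (H →L[ℂ] H) →ₗ[ℂ] (H →L[ℂ] H)) : Prop :=
  ∀ T, IsTraceClass T → ∃ T', IsTraceClass T' ∧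
    ∀ A ∈ M, pairing b (φ A) T = pairing b A T'

/-- The map `Ad_V : X ↦ V* X V`. -/
def AdL (V : H →L[ℂ] H) : (H →L[ℂ] H) →ₗ[ℂ] (H →L[ℂ] H) where
  toFun X := star V * X * V
  map_add' X Y := by simp [add_mul, mul_add]
  map_smul' c X := by simp [smul_mul_assoc, mul_smul_comm]

/-- `p` is a minimal (nonzero) projection in `M`. -/
def IsMinimalProjection (M : VonNeumannAlgebra H) (p : H →L[ℂ] H) : Prop :=
  p ∈ M ∧ IsIdempotentElem p ∧ IsSelfAdjoint p ∧ p ≠ 0 ∧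
    ∀ q, q ∈ M → IsIdempotentElem q → IsSelfAdjoint q → q ≠ 0 →
      q * p = q → p * q = q → q = p

/-- A factor is of type I precisely when it contains a minimal projection. -/
def IsTypeI (M : VonNeumannAlgebra H) : Prop :=
  ∃ p, IsMinimalProjection M p




variable {K : Type*} [NormedAddCommGroup K] [InnerProductSpace ℂ K] [CompleteSpace K]

/-- `T` is a Hilbert–Schmidt operator (relative to a Hilbert basis `e`;
this does not depend on the choice of `e`). -/
def IsHS {ι : Type*} (e : HilbertBasis ι ℂ K) (T : K →L[ℂ] K) : Prop :=
  Summable fun i => ‖T (e i)‖ ^ 2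

/-- A model of the Hilbert space `HS(K)` of Hilbert–Schmidt operators on `K`,
with `B(K)` acting by left multiplications `Lmul` and right multiplications
`Rmul`.  `toOp` regards a vector of `H` as an operator on `K`; its range is
exactly the set of Hilbert–Schmidt operators, and the inner product of `H` is
`(x|y) = Tr (x y*)`, i.e. `⟪x, y⟫ = Σᵢ ⟪x eᵢ, y eᵢ⟫`. -/
structure HSModel {ι : Type*} (e : HilbertBasis ι ℂ K) (H : Type*)
    [NormedAddCommGroup H] [InnerProductSpace ℂ H] [CompleteSpace H] where
  toOp : H →ₗ[ℂ] (K →L[ℂ] K)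
  inj : Function.Injective toOp
  mem_range : ∀ T : K →L[ℂ] K, IsHS e T ↔ ∃ x : H, toOp x = T
  inner_eq : ∀ x y : H, ⟪x, y⟫ = ∑' i, ⟪toOp x (e i), toOp y (e i)⟫
  Lmul : (K →L[ℂ] K) → (H →L[ℂ] H)
  Lmul_eq : ∀ a x, toOp (Lmul a x) = a ∘L toOp x
  Rmul : (K →L[ℂ] K) → (H →L[ℂ] H)
  Rmul_eq : ∀ a x, toOp (Rmul a x) = toOp x ∘L a

/-- The operator `T` has rank at most `k`. -/
def rankLE (T : K →L[ℂ] K) (k : ℕ) : Prop :=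
  Module.rank ℂ (LinearMap.range (T : K →ₗ[ℂ] K)) ≤ (k : Cardinal)

variable {H : Type*} [NormedAddCommGroup H] [InnerProductSpace ℂ H] [CompleteSpace H]
  {ι : Type*} {e : HilbertBasis ι ℂ K}

/-- `Φ` restricts to the map `φ̃ : R_y L_x ↦ R_y L_{φ(x)}` on `alg(M', M)` for
`M = L_{B(K)}`. -/
def HSExt (m : HSModel e H) (φ : (K →L[ℂ] K) →ₗ[ℂ] (K →L[ℂ] K))
    (Φ : (H →L[ℂ] H) →ₗ[ℂ] (H →L[ℂ] H)) : Prop :=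
  ∀ a x : K →L[ℂ] K, Φ (m.Rmul a ∘L m.Lmul x) = m.Rmul a ∘L m.Lmul (φ x)

/-- `φ` is `k`-positive. -/
def kPos (k : ℕ) (φ : (K →L[ℂ] K) →ₗ[ℂ] (K →L[ℂ] K)) : Prop :=
  ∀ A : Fin k → Fin k → (K →L[ℂ] K), MatPos A → MatPos fun i j => φ (A i j)

/-- `φ` is completely bounded (as a map on all of `B(K)`). -/
def IsCBFullK (φ : (K →L[ℂ] K) →ₗ[ℂ] (K →L[ℂ] K)) : Prop :=
  ∃ c, 0 ≤ c ∧ ∀ (k : ℕ) (A : Fin k → Fin k → (K →L[ℂ] K)),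
    matNormLe A 1 → matNormLe (fun i j => φ (A i j)) c

/-- `φ` belongs to `CB^σ(B(K))`: it is normal and completely bounded. -/
def NormalCB (e : HilbertBasis ι ℂ K) (φ : (K →L[ℂ] K) →ₗ[ℂ] (K →L[ℂ] K)) : Prop :=
  (∃ φst, IsNormalPair e φ φst) ∧ IsCBFullK φ

/-- The cone `𝒮_k` of `T(H)`: the trace-norm closed convex cone generated by
the `ω_{x,x} = x ⊠ x` with `rank x ≤ k` (rank as an operator on `K`). -/
def SchmidtCone (m : HSModel e H) (k : ℕ) : Set (H →L[ℂ] H) :=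
  {T | ∀ ε : ℝ, 0 < ε → ∃ (n : ℕ) (x : Fin n → H),
    (∀ i, rankLE (m.toOp (x i)) k) ∧
      traceNorm (T - ∑ i, rankOne (x i) (x i)) < ε}

/-- `ψ` belongs to the convex cone `𝔼_k` generated by the maps `Ad_V` with
`rank V ≤ k`. -/
def InEk (k : ℕ) (ψ : (K →L[ℂ] K) →ₗ[ℂ] (K →L[ℂ] K)) : Prop :=
  ∃ (n : ℕ) (V : Fin n → (K →L[ℂ] K)), (∀ i, rankLE (V i) k) ∧
    ∀ x, ψ x = ∑ i, star (V i) * x * V i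

/-- `φ` (with Choi trace-class operator `Dphi = D_φ`) is `k`-superpositive:
it lies in the `‖·‖_D`-closure of the cone `𝔼_k`, where `‖ψ‖_D = ‖D_ψ‖_{T(H)}`. -/
def kSuper {ιH : Type*} (bH : HilbertBasis ιH ℂ H) (m : HSModel e H) (x0 : H)
    (k : ℕ) (Dphi : H →L[ℂ] H) : Prop :=
  ∀ ε : ℝ, 0 < ε → ∃ ψ Ψ Ψst, InEk k ψ ∧ HSExt m ψ Ψ ∧ IsNormalPair bH Ψ Ψst ∧
    traceNorm (Dphi - Ψst (rankOne x0 x0)) < ε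


section PositivityCriterion

set_option linter.unusedSectionVars false

lemma norm_inner_self_eq_sq (x : K) : ‖⟪x, x⟫‖ = ‖x‖ * ‖x‖ := by
  rw [inner_self_eq_norm_sq_to_K]; simp [sq]

lemma isPositive_of_inner_nonneg {T : K →L[ℂ] K} (h : ∀ v, 0 ≤ ⟪v, T v⟫) : T.IsPositive := by
  rw [ContinuousLinearMap.isPositive_iff_complex]
  intro v
  have h1 := h v
  rw [← inner_conj_symm] at h1
  rw [Complex.nonneg_iff] at h1
  simp only [Complex.conj_re, Complex.conj_im] at h1
  refine ⟨?_, h1.1⟩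
  apply Complex.ext
  · simp
  · simpa [eq_comm] using h1.2

lemma rankOne_apply (x y z : K) : rankOne x y z = ⟪y, z⟫ • x := rfl

lemma rankOne_self_isPositive (x : K) : (rankOne x x).IsPositive := by
  refine isPositive_of_inner_nonneg fun v => ?_
  rw [rankOne_apply, inner_smul_right, ← inner_conj_symm, ← Complex.normSq_eq_conj_mul_self]
  exact_mod_cast Complex.normSq_nonneg _

lemma rankOne_isTraceClass (x y : K) : IsTraceClass (rankOne x y) := by
  classical
  refine ⟨fun n => if n = 0 then x else 0, fun n => if n = 0 then y else 0, ?_, fun z => ?_⟩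
  · refine summable_of_ne_finset_zero (s := {0}) fun n hn => ?_
    simp_all
  · rw [tsum_eq_single 0 (by intro n hn; simp [hn])]
    simp [rankOne_apply]

lemma summable_norm_inner_mul_norm_inner (b : HilbertBasis ι ℂ K) {N : Type*} {x y : N → K}
    (h : Summable fun n => ‖x n‖ * ‖y n‖) :
    Summable fun p : N × ι => ‖⟪y p.1, b p.2⟫‖ * ‖⟪b p.2, x p.1⟫‖ := by
  have bd : ∀ (u v : K) (s : Finset ι), ∑ i ∈ s, ‖⟪v, b i⟫‖ * ‖⟪b i, u⟫‖ ≤ ‖u‖ * ‖v‖ := by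
    intro u v s
    have key : ∀ w : K, √(∑ i ∈ s, ‖⟪b i, w⟫‖ ^ 2) ≤ ‖w‖ := fun w =>
      Real.sqrt_le_iff.2 ⟨norm_nonneg _, b.orthonormal.sum_inner_products_le w⟩
    calc ∑ i ∈ s, ‖⟪v, b i⟫‖ * ‖⟪b i, u⟫‖ = ∑ i ∈ s, ‖⟪b i, u⟫‖ * ‖⟪b i, v⟫‖ :=
          Finset.sum_congr rfl fun i _ => by rw [norm_inner_symm v, mul_comm]
      _ ≤ _ := Real.sum_mul_le_sqrt_mul_sqrt s _ _
      _ ≤ _ := mul_le_mul (key u) (key v) (Real.sqrt_nonneg _) (norm_nonneg _)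
  have nn : ∀ n i, 0 ≤ ‖⟪y n, b i⟫‖ * ‖⟪b i, x n⟫‖ := fun n i => by positivity
  rw [summable_prod_of_nonneg fun p => nn p.1 p.2]
  refine ⟨fun n => summable_of_sum_le (nn n) (bd (x n) (y n)), ?_⟩
  exact Summable.of_nonneg_of_le (fun n => tsum_nonneg (nn n))
    (fun n => Real.tsum_le_of_sum_le (nn n) (bd (x n) (y n))) h

lemma summable_nuclear {N : Type*} {x y : N → K} (h : Summable fun n => ‖x n‖ * ‖y n‖) (z : K) :
    Summable fun n => ⟪y n, z⟫ • x n := by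
  refine Summable.of_norm_bounded (h.mul_right ‖z‖) fun n => ?_
  rw [norm_smul]
  calc ‖⟪y n, z⟫‖ * ‖x n‖ ≤ (‖y n‖ * ‖z‖) * ‖x n‖ := by gcongr; exact norm_inner_le_norm _ _
    _ = _ := by ring

/-- The trace of `A ∘ T` may be computed from any nuclear representation of `T`. -/
lemma pairing_eq_tsum (b : HilbertBasis ι ℂ K) {N : Type*} {x y : N → K}
    (h : Summable fun n => ‖x n‖ * ‖y n‖) {T : K →L[ℂ] K}
    (hT : ∀ z, T z = ∑' n, ⟪y n, z⟫ • x n) (A : K →L[ℂ] K) :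
    pairing b A T = ∑' n, ⟪y n, A (x n)⟫ := by
  have hA : Summable fun n => ‖A (x n)‖ * ‖y n‖ := by
    refine Summable.of_nonneg_of_le (fun n => by positivity) (fun n => ?_) (h.mul_left ‖A‖)
    rw [← mul_assoc]
    gcongr
    exact A.le_opNorm _
  have hs : Summable fun p : N × ι => ⟪y p.1, b p.2⟫ * ⟪b p.2, A (x p.1)⟫ := by
    apply Summable.of_norm
    simpa only [norm_mul] using summable_norm_inner_mul_norm_inner b hA
  have e1 : ∀ i, ⟪b i, (A ∘L T) (b i)⟫ = ∑' n, ⟪y n, b i⟫ * ⟪b i, A (x n)⟫ := by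
    intro i
    rw [ContinuousLinearMap.comp_apply, hT]
    have := ((summable_nuclear h (b i)).hasSum.mapL ((innerSL ℂ (b i)) ∘L A)).tsum_eq
    simpa [inner_smul_right] using this.symm
  unfold pairing tr
  simp_rw [e1]
  rw [Summable.tsum_comm (f := fun n i => ⟪y n, b i⟫ * ⟪b i, A (x n)⟫) hs]
  exact tsum_congr fun n => b.tsum_inner_mul_inner _ _

lemma pairing_rankOne_right (b : HilbertBasis ι ℂ K) (A : K →L[ℂ] K) (x y : K) :
    pairing b A (rankOne x y) = ⟪y, A x⟫ := by
  rw [pairing_eq_tsum b (N := Unit) (x := fun _ => x) (y := fun _ => y)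
    (Summable.of_finite)
    (fun z => by simp [rankOne_apply])]
  simp

lemma pairing_rankOne_left (b : HilbertBasis ι ℂ K) (F : K →L[ℂ] K) (x y : K) :
    pairing b (rankOne x y) F = ⟪y, F x⟫ := by
  unfold pairing tr
  rw [← ContinuousLinearMap.adjoint_inner_left, ← b.tsum_inner_mul_inner]
  refine tsum_congr fun i => ?_
  rw [ContinuousLinearMap.comp_apply, rankOne_apply, inner_smul_right,
    ContinuousLinearMap.adjoint_inner_left]

/-- A positive trace class operator is a sum `∑ gᵢ ⊠ gᵢ` with `∑ ‖gᵢ‖² < ∞`. -/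
lemma exists_square_nuclear (b : HilbertBasis ι ℂ K) {T : K →L[ℂ] K} (hT : IsTraceClass T)
    (hpos : T.IsPositive) :
    ∃ g : ι → K, Summable (fun i => ‖g i‖ * ‖g i‖) ∧
      ∀ z, HasSum (fun i => ⟪g i, z⟫ • g i) (T z) := by
  have h0 : 0 ≤ T := (ContinuousLinearMap.nonneg_iff_isPositive T).2 hpos
  set r : K →L[ℂ] K := CFC.sqrt T with hr
  have hrr : r * r = T := CFC.sqrt_mul_sqrt_self T h0
  have hrs : ∀ u v, ⟪r u, v⟫ = ⟪u, r v⟫ :=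
    ((ContinuousLinearMap.nonneg_iff_isPositive r).1 (CFC.sqrt_nonneg T)).isSymmetric
  have hTr : ∀ z, T z = r (r z) := fun z => by rw [← hrr]; rfl
  refine ⟨fun i => r (b i), ?_, fun z => ?_⟩
  · obtain ⟨x, y, hxy, hx⟩ := hT
    have hs : Summable fun i => ⟪b i, T (b i)⟫ := by
      have h2 : Summable fun p : ι × ℕ => ⟪y p.2, b p.1⟫ * ⟪b p.1, x p.2⟫ := by
        apply Summable.of_norm
        simp only [norm_mul]
        exact (summable_norm_inner_mul_norm_inner b hxy).prod_symm
      refine h2.prod.congr fun i => ?_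
      rw [hx]
      have := ((summable_nuclear hxy (b i)).hasSum.mapL (innerSL ℂ (b i))).tsum_eq
      simpa [inner_smul_right] using this
    refine hs.norm.congr fun i => ?_
    rw [hTr, ← hrs, inner_self_eq_norm_sq_to_K]
    simp [sq]
  · rw [hTr]
    have := (b.hasSum_repr (r z)).mapL r
    simpa [b.repr_apply_apply, hrs] using this

lemma pairing_nonneg (b : HilbertBasis ι ℂ K) {T x : K →L[ℂ] K} (hT : IsTraceClass T)
    (hpos : T.IsPositive) (hx : x.IsPositive) : 0 ≤ pairing b x T := by
  obtain ⟨g, hg, hgT⟩ := exists_square_nuclear b hT hpos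
  rw [pairing_eq_tsum b hg (fun z => (hgT z).tsum_eq.symm)]
  exact tsum_nonneg fun i => hx.inner_nonneg_right _

/-- A completely bounded map is bounded. -/
lemma IsCBFullK.exists_continuousLinearMap {φ : (K →L[ℂ] K) →ₗ[ℂ] (K →L[ℂ] K)}
    (h : IsCBFullK φ) : ∃ ψ : (K →L[ℂ] K) →L[ℂ] (K →L[ℂ] K), ∀ A, φ A = ψ A := by
  obtain ⟨c, hc, h⟩ := h
  have unit : ∀ A : K →L[ℂ] K, ‖A‖ ≤ 1 → ‖φ A‖ ≤ c := by
    intro A hA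
    refine ContinuousLinearMap.opNorm_le_bound _ hc fun v => ?_
    have h1 := h 1 (fun _ _ => A) (fun v w => by
      simp only [Fin.sum_univ_one, Real.sqrt_sq (norm_nonneg _), one_mul]
      calc ‖⟪w 0, A (v 0)⟫‖ ≤ ‖w 0‖ * ‖A (v 0)‖ := norm_inner_le_norm _ _
        _ ≤ ‖w 0‖ * (1 * ‖v 0‖) := by
            gcongr; exact (A.le_opNorm _).trans (by gcongr)
        _ = _ := by ring) (fun _ => v) (fun _ => φ A v)
    simp only [Fin.sum_univ_one, Real.sqrt_sq (norm_nonneg _), norm_inner_self_eq_sq] at h1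
    rcases (norm_nonneg (φ A v)).eq_or_lt with h2 | h2
    · rw [← h2]; positivity
    · exact le_of_mul_le_mul_right h1 h2
  refine ⟨φ.mkContinuous c fun A => ?_, fun A => rfl⟩
  by_cases hA : A = 0
  · simp [hA]
  have hn : ‖A‖ ≠ 0 := norm_ne_zero_iff.2 hA
  have := unit (((‖A‖ : ℂ)⁻¹) • A) (by rw [norm_smul]; simp [hn])
  rw [map_smul, norm_smul] at this
  simp only [norm_inv, Complex.norm_real, norm_norm] at this
  rwa [inv_mul_le_iff₀ (by positivity), mul_comm] at this

end PositivityCriterion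

section HSModelLemmas

set_option linter.unusedSectionVars false

variable (m : HSModel e H)

lemma rankOne_eq (x y : K) : rankOne x y = InnerProductSpace.rankOne ℂ x y := by
  ext z; simp [rankOne_apply]

lemma continuous_innerProductSpace_rankOne :
    Continuous fun p : K × K => InnerProductSpace.rankOne ℂ p.1 p.2 :=
  ((smulRightL ℂ K K).continuous.comp ((innerSL ℂ).continuous.comp continuous_snd)).clm_apply
    continuous_fst

lemma isHS_rankOne (e : HilbertBasis ι ℂ K) (x y : K) : IsHS e (rankOne x y) := by
  have := (e.orthonormal.inner_products_summable y).mul_right (‖x‖ ^ 2)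
  refine this.congr fun i => ?_
  rw [rankOne_apply, norm_smul, mul_pow, norm_inner_symm]

/-- The rank one operator `x ⊠ y` as a vector of the Hilbert–Schmidt space. -/
def HSModel.vec (x y : K) : H := ((m.mem_range _).1 (isHS_rankOne e x y)).choose

lemma HSModel.toOp_vec (x y : K) : m.toOp (m.vec x y) = rankOne x y :=
  ((m.mem_range _).1 (isHS_rankOne e x y)).choose_spec

lemma HSModel.inner_vec (x y : K) (u : H) : ⟪m.vec x y, u⟫ = ⟪x, m.toOp u y⟫ := by
  rw [m.inner_eq, ← ContinuousLinearMap.adjoint_inner_left, ← e.tsum_inner_mul_inner]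
  refine tsum_congr fun i => ?_
  rw [m.toOp_vec, rankOne_apply, inner_smul_left, inner_conj_symm,
    ContinuousLinearMap.adjoint_inner_left, mul_comm]

lemma HSModel.ext_vec {u v : H} (h : ∀ x y, ⟪m.vec x y, u⟫ = ⟪m.vec x y, v⟫) : u = v := by
  apply m.inj
  ext y
  refine ext_inner_left ℂ fun x => ?_
  rw [← m.inner_vec, ← m.inner_vec, h]

lemma HSModel.norm_vec (x y : K) : ‖m.vec x y‖ = ‖x‖ * ‖y‖ := by
  have h : ‖m.vec x y‖ * ‖m.vec x y‖ = (‖x‖ * ‖y‖) * (‖x‖ * ‖y‖) := by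
    rw [← norm_inner_self_eq_sq, m.inner_vec, m.toOp_vec, rankOne_apply, inner_smul_right,
      norm_mul, norm_inner_self_eq_sq, norm_inner_self_eq_sq]
    ring
  exact (mul_self_inj (norm_nonneg _) (by positivity)).1 h

/-- Evaluation of Hilbert–Schmidt operators at a vector. -/
def HSModel.eval (y : K) : H →L[ℂ] K :=
  LinearMap.mkContinuous
    { toFun := fun u => m.toOp u y
      map_add' := fun u v => by simp
      map_smul' := fun c u => by simp } ‖y‖ fun u => by
    have h : ‖m.toOp u y‖ * ‖m.toOp u y‖ ≤ (‖y‖ * ‖u‖) * ‖m.toOp u y‖ := by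
      calc ‖m.toOp u y‖ * ‖m.toOp u y‖ = ‖⟪m.vec (m.toOp u y) y, u⟫‖ := by
            rw [m.inner_vec, norm_inner_self_eq_sq]
        _ ≤ ‖m.vec (m.toOp u y) y‖ * ‖u‖ := norm_inner_le_norm _ _
        _ = _ := by rw [m.norm_vec]; ring
    rcases (norm_nonneg (m.toOp u y)).eq_or_lt with h2 | h2
    · simp only [LinearMap.coe_mk, AddHom.coe_mk]
      rw [← h2]; positivity
    · exact le_of_mul_le_mul_right h h2

lemma HSModel.eval_apply (y : K) (u : H) : m.eval y u = m.toOp u y := rfl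

lemma HSModel.vec_induction {P : H → Prop} (hc : IsClosed {u | P u}) (h0 : P 0)
    (hadd : ∀ u v, P u → P v → P (u + v)) (hsmul : ∀ (c : ℂ) u, P u → P (c • u))
    (hvec : ∀ x y, P (m.vec x y)) (u : H) : P u := by
  let S : Submodule ℂ H := Submodule.span ℂ {w | ∃ x y, w = m.vec x y}
  have htop : S.topologicalClosure = ⊤ := by
    rw [Submodule.topologicalClosure_eq_top_iff, Submodule.eq_bot_iff]
    intro w hw
    refine m.ext_vec fun x y => ?_
    rw [inner_zero_right]
    exact (Submodule.mem_orthogonal S w).1 hw _ (Submodule.subset_span ⟨x, y, rfl⟩)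
  have hu : u ∈ closure (S : Set H) := by
    rw [← Submodule.topologicalClosure_coe, htop]; trivial
  refine closure_minimal (fun v hv => ?_) hc hu
  refine Submodule.span_induction (p := fun v _ => P v) ?_ h0 (fun u v _ _ => hadd u v)
    (fun c u _ => hsmul c u) hv
  rintro _ ⟨x, y, rfl⟩
  exact hvec x y

lemma HSModel.rankOne_vec (a b c d : K) :
    rankOne (m.vec c b) (m.vec d a) = m.Rmul (rankOne a b) ∘L m.Lmul (rankOne c d) := by
  ext u
  apply m.inj
  ext z
  rw [ContinuousLinearMap.comp_apply, m.Rmul_eq, m.Lmul_eq, rankOne_apply, m.inner_vec]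
  simp only [m.toOp_vec, map_smul, rankOne_apply, ContinuousLinearMap.comp_apply,
    FunLike.coe_smul, Pi.smul_apply, smul_smul]
  congr 1
  ring

/-- The quadratic form of `Φ (x₀ ⊠ x₀)` on rank one vectors, in terms of `φ`. -/
lemma HSModel.inner_vec_ext {ιH : Type*} {bH : HilbertBasis ιH ℂ H}
    {φ : (K →L[ℂ] K) →ₗ[ℂ] (K →L[ℂ] K)} (hφ : IsCBFullK φ)
    {Φ Φst : (H →L[ℂ] H) →ₗ[ℂ] (H →L[ℂ] H)}
    (hext : HSExt m φ Φ) (hnp : IsNormalPair bH Φ Φst) (x0 : H) (x y : K) :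
    ⟪m.vec x y, Φ (rankOne x0 x0) (m.vec x y)⟫ =
      ⟪x, φ (rankOne (m.toOp x0 y) (m.toOp x0 y)) x⟫ := by
  set F := Φst (rankOne (m.vec x y) (m.vec x y)) with hF
  have hpair : ∀ A, ⟪m.vec x y, Φ A (m.vec x y)⟫ = pairing bH A F := fun A => by
    rw [← pairing_rankOne_right bH, hnp.2 _ _ (rankOne_isTraceClass _ _)]
  obtain ⟨φ', hφ'⟩ := hφ.exists_continuousLinearMap
  suffices h : ∀ u v : H, ⟪u, F v⟫ =
      ⟪x, φ' (InnerProductSpace.rankOne ℂ (m.eval y v) (m.eval y u)) x⟫ by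
    rw [hpair, pairing_rankOne_left, h, rankOne_eq, hφ']
    rfl
  intro u
  refine m.vec_induction ?_ ?_ ?_ ?_ ?_
  · have := continuous_innerProductSpace_rankOne.comp
      ((m.eval y).continuous.prodMk (continuous_const (y := m.eval y u)))
    exact isClosed_eq (by fun_prop) (by fun_prop)
  · simp
  · intro v w hv hw
    simp only [map_add, inner_add_right, hv, hw, _root_.add_apply]
  · intro c v hv
    simp only [map_smul, inner_smul_right, hv, _root_.smul_apply]
  intro p q
  revert u
  refine m.vec_induction ?_ ?_ ?_ ?_ ?_
  · have := continuous_innerProductSpace_rankOne.comp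
      ((continuous_const (y := m.eval y (m.vec p q))).prodMk (m.eval y).continuous)
    exact isClosed_eq (by fun_prop) (by fun_prop)
  · simp
  · intro v w hv hw
    simp only [map_add, inner_add_left, inner_add_right, hv, hw, _root_.add_apply]
  · intro c v hv
    simp only [map_smul, map_smulₛₗ, inner_smul_left, inner_smul_right, hv,
      _root_.smul_apply]
  intro d a
  rw [← pairing_rankOne_left bH, ← hpair, m.rankOne_vec, hext, m.inner_vec,
    ContinuousLinearMap.comp_apply, m.Rmul_eq, m.Lmul_eq]
  simp only [m.eval_apply, m.toOp_vec, rankOne_apply, ContinuousLinearMap.comp_apply, map_smul,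
    map_smulₛₗ, inner_smul_right, _root_.smul_apply, inner_conj_symm,
    ← rankOne_eq]
  rw [hφ']
  ring

lemma HSModel.Lmul_comp_Rmul_rankOne (x y : K) :
    m.Lmul (rankOne x x) ∘L m.Rmul (rankOne y y) = rankOne (m.vec x y) (m.vec x y) := by
  ext u
  apply m.inj
  ext z
  rw [ContinuousLinearMap.comp_apply, m.Lmul_eq, m.Rmul_eq, rankOne_apply, m.inner_vec]
  simp only [m.toOp_vec, map_smul, rankOne_apply, ContinuousLinearMap.comp_apply,
    FunLike.coe_smul, Pi.smul_apply, smul_smul]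
  congr 1
  ring

lemma HSModel.Lmul_comp_Rmul_nuclear {s t : K →L[ℂ] K} {f g : ι → K}
    (hf : Summable fun i => ‖f i‖ * ‖f i‖) (hft : ∀ z, HasSum (fun i => ⟪f i, z⟫ • f i) (t z))
    (hg : Summable fun i => ‖g i‖ * ‖g i‖) (hgs : ∀ z, HasSum (fun i => ⟪g i, z⟫ • g i) (s z)) :
    Summable (fun p : ι × ι => ‖m.vec (f p.1) (g p.2)‖ * ‖m.vec (f p.1) (g p.2)‖) ∧
      ∀ u, (m.Lmul t ∘L m.Rmul s) u =
        ∑' p : ι × ι, ⟪m.vec (f p.1) (g p.2), u⟫ • m.vec (f p.1) (g p.2) := by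
  have hsum : Summable (fun p : ι × ι => ‖m.vec (f p.1) (g p.2)‖ * ‖m.vec (f p.1) (g p.2)‖) := by
    refine (hf.mul_of_nonneg hg (fun i => by positivity) (fun i => by positivity)).congr
      fun p => ?_
    rw [m.norm_vec]; ring
  refine ⟨hsum, fun u => m.ext_vec fun x y => ?_⟩
  have h1 := (summable_nuclear hsum u).hasSum.mapL (innerSL ℂ (m.vec x y))
  have h2 : ∀ i, HasSum
      (fun j => innerSL ℂ (m.vec x y) (⟪m.vec (f i) (g j), u⟫ • m.vec (f i) (g j)))
      (⟪f i, m.toOp u (s y)⟫ * ⟪x, f i⟫) := fun i => by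
    have h3 := ((hgs y).mapL (innerSL ℂ (f i) ∘L m.toOp u)).mul_right ⟪x, f i⟫
    refine h3.congr_fun fun j => ?_
    simp only [innerSL_apply_apply, inner_smul_right, m.inner_vec, m.toOp_vec, rankOne_apply,
      ContinuousLinearMap.comp_apply, map_smul, smul_eq_mul]
    ring
  have h4 : HasSum (fun i => ⟪f i, m.toOp u (s y)⟫ * ⟪x, f i⟫) ⟪x, t (m.toOp u (s y))⟫ := by
    refine ((hft (m.toOp u (s y))).mapL (innerSL ℂ x)).congr_fun fun i => ?_
    rw [innerSL_apply_apply, inner_smul_right]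
  rw [ContinuousLinearMap.comp_apply, m.inner_vec, m.Lmul_eq, m.Rmul_eq]
  exact h4.unique (h1.prod_fiberwise h2)

lemma HSModel.dense_range (x0 : H)
    (hsep : ∀ a : K →L[ℂ] K, m.Lmul a x0 = 0 → m.Lmul a = 0) :
    DenseRange (m.toOp x0) := by
  have htop : (LinearMap.range (m.toOp x0 : K →ₗ[ℂ] K)).topologicalClosure = ⊤ := by
    rw [Submodule.topologicalClosure_eq_top_iff, Submodule.eq_bot_iff]
    intro w hw
    have h0 : m.Lmul (rankOne w w) = 0 := by
      refine hsep _ (m.inj ?_)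
      rw [m.Lmul_eq, map_zero]
      ext z
      have : ⟪w, m.toOp x0 z⟫ = 0 := (Submodule.mem_orthogonal' _ w).1 hw _ ⟨z, rfl⟩
      simp [rankOne_apply, this]
    have h1 := congrArg m.toOp (DFunLike.congr_fun h0 (m.vec w w))
    rw [m.Lmul_eq, m.toOp_vec] at h1
    have h2 := congrArg (fun T : K →L[ℂ] K => ⟪w, T w⟫) h1
    simpa [rankOne_apply, inner_smul_right] using h2
  have := Submodule.dense_iff_topologicalClosure_eq_top.2 htop
  exact this

end HSModelLemmas

/-- Theorem 4.4.  Let `B(K)` act on `H = HS(K)` by left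
multiplications with separating and cyclic vector `x0`.  For a normal
completely bounded `φ : B(K) → B(K)` (with normal extension `Φ` of `φ̃` and
predual `Φst`), `φ` is positive if and only if `⟨C_φ, σ'·τ⟩ ≥ 0` for every
positive normal functional `σ'` on the commutant `R_{B(K)}` and every positive
normal functional `τ` on `B(K)`.  Here positive normal functionals on
`R_{B(K)}` resp. `B(K)` are implemented by positive trace class operators
`s`, `t` on `K` via `σ'(R_y) = Tr(y s)` and `τ(x) = Tr(x t)`, and `σ'·τ` is
then implemented by the trace class operator `L_t R_s` on `H`. -/
theorem statement10
    {K : Type*} [NormedAddCommGroup K] [InnerProductSpace ℂ K] [CompleteSpace K]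
    [TopologicalSpace.SeparableSpace K]
    {ι : Type*} (e : HilbertBasis ι ℂ K)
    {H : Type*} [NormedAddCommGroup H] [InnerProductSpace ℂ H] [CompleteSpace H]
    {ιH : Type*} (bH : HilbertBasis ιH ℂ H)
    (m : HSModel e H) (x0 : H) (hx0 : ‖x0‖ = 1)
    (hcyc : Dense {y : H | ∃ a : K →L[ℂ] K, m.Lmul a x0 = y})
    (hsep : ∀ a : K →L[ℂ] K, m.Lmul a x0 = 0 → m.Lmul a = 0)
    (φ : (K →L[ℂ] K) →ₗ[ℂ] (K →L[ℂ] K)) (hφ : NormalCB e φ)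
    (Φ Φst : (H →L[ℂ] H) →ₗ[ℂ] (H →L[ℂ] H))
    (hext : HSExt m φ Φ) (hnp : IsNormalPair bH Φ Φst) :
    (∀ x : K →L[ℂ] K, x.IsPositive → (φ x).IsPositive) ↔
    (∀ s t : K →L[ℂ] K, IsTraceClass s → s.IsPositive →
      IsTraceClass t → t.IsPositive →
      0 ≤ pairing bH (Φ (rankOne x0 x0)) (m.Lmul t ∘L m.Rmul s)) := by
  constructor
  · intro h s t hs hsp ht htp
    obtain ⟨g, hg, hgs⟩ := exists_square_nuclear e hs hsp
    obtain ⟨f, hf, hft⟩ := exists_square_nuclear e ht htp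
    obtain ⟨hsum, hT⟩ := m.Lmul_comp_Rmul_nuclear hf hft hg hgs
    rw [pairing_eq_tsum bH hsum hT]
    refine tsum_nonneg fun p => ?_
    rw [m.inner_vec_ext hφ.2 hext hnp]
    exact (h _ (rankOne_self_isPositive _)).inner_nonneg_right _
  · intro h
    obtain ⟨⟨φst, hst, hφst⟩, hcb⟩ := hφ
    have hrange : ∀ x y : K, 0 ≤ ⟪x, φ (rankOne (m.toOp x0 y) (m.toOp x0 y)) x⟫ := by
      intro x y
      rw [← m.inner_vec_ext hcb hext hnp, ← pairing_rankOne_right bH,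
        ← m.Lmul_comp_Rmul_rankOne]
      exact h _ _ (rankOne_isTraceClass _ _) (rankOne_self_isPositive _)
        (rankOne_isTraceClass _ _) (rankOne_self_isPositive _)
    obtain ⟨φ', hφ'⟩ := hcb.exists_continuousLinearMap
    have hrank : ∀ x z : K, 0 ≤ ⟪x, φ (rankOne z z) x⟫ := by
      intro x z
      refine (m.dense_range x0 hsep).induction_on
        (p := fun z => 0 ≤ ⟪x, φ (rankOne z z) x⟫) z ?_ (hrange x)
      have hcont : Continuous fun z : K => ⟪x, φ' (InnerProductSpace.rankOne ℂ z z) x⟫ := by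
        have := (continuous_innerProductSpace_rankOne (K := K)).comp
          (continuous_id.prodMk continuous_id)
        fun_prop
      simp only [rankOne_eq, hφ']
      exact isClosed_le continuous_const hcont
    intro x hx
    refine isPositive_of_inner_nonneg fun v => ?_
    rw [← pairing_rankOne_right e, hφst _ _ (rankOne_isTraceClass _ _)]
    refine pairing_nonneg e (hst _ (rankOne_isTraceClass _ _)) ?_ hx
    refine isPositive_of_inner_nonneg fun z => ?_
    rw [← pairing_rankOne_left e, ← hφst _ _ (rankOne_isTraceClass _ _),
      pairing_rankOne_right]
    exact hrank v z

end ChoiInf
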